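/- Let X and Y be first countable compact Hausdorff spaces. Then every local diameter-preserving linear map T : C(X) → C(Y) is a diameter-preserving linear bijection. In other words, the set of all diameter-preserving linear bijections from C(X) to C(Y) is algebraically reflexive. -/

import Mathlib

/-- A map between continuous complex-valued function spaces is diameter-preserving if it
preserves the diameter of the range of every function. -/
def DiamPreserving {X Y : Type*} [TopologicalSpace X] [TopologicalSpace Y]
    (T : C(X, ℂ) → C(Y, ℂ)) : Prop :=
  ∀ f : C(X, ℂ), Metric.diam (Set.range (T f)) = Metric.diam (Set.range f)

/-- A linear map `T : C(X) → C(Y)` is local diameter-preserving if for every `f` there is a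
diameter-preserving linear bijection `S` (depending on `f`) with `T f = S f`. -/
def LocalDiamPreserving {X Y : Type*} [TopologicalSpace X] [TopologicalSpace Y]
    (T : C(X, ℂ) →ₗ[ℂ] C(Y, ℂ)) : Prop :=
  ∀ f : C(X, ℂ), ∃ S : C(X, ℂ) →ₗ[ℂ] C(Y, ℂ),
    Function.Bijective S ∧ DiamPreserving ⇑S ∧ T f = S f

open Set ContinuousMap

theorem IsCompact.subset_image_of_isometry {E : Type*} [MetricSpace E] {K : Set E}
    (hK : IsCompact K) {j : E → E} (hj : Isometry j) (hm : MapsTo j K K) : K ⊆ j '' K := by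
  intro p hp
  by_contra hpj
  have hcl : IsClosed (j '' K) := (hK.image hj.continuous).isClosed
  obtain ⟨ε, hε, hball⟩ := Metric.isOpen_iff.1 hcl.isOpen_compl p hpj
  have hmem : ∀ n, j^[n] p ∈ K := fun n => hm.iterate n hp
  obtain ⟨a, -, φ, hφ, hlim⟩ := hK.tendsto_subseq hmem
  obtain ⟨N, hN⟩ := Metric.cauchySeq_iff.1 hlim.cauchySeq ε hε
  have hlt := hN (N + 1) (by omega) N le_rfl
  obtain ⟨k, hk⟩ := Nat.exists_eq_add_of_lt (hφ (Nat.lt_succ_self N))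
  have hiter : ∀ n, Isometry (j^[n]) := fun n => by
    induction n with
    | zero => exact isometry_id
    | succ n ih => exact ih.comp hj
  simp only [Function.comp_apply] at hlt
  rw [show φ (N + 1) = φ N + (k + 1) by simpa [add_assoc] using hk, Function.iterate_add_apply,
    (hiter _).dist_eq] at hlt
  refine hball (Metric.mem_ball.2 hlt) ?_
  rw [Function.iterate_succ_apply']
  exact mem_image_of_mem _ (hmem k)

/-- A linear functional on `C(X, ℂ)` whose value at each function belongs to the range of that
function is the evaluation at a point. -/
theorem exists_eval_eq_of_mem_range {X : Type*} [TopologicalSpace X] [CompactSpace X] [T2Space X]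
    (F : C(X, ℂ) →ₗ[ℂ] ℂ) (hF : ∀ f : C(X, ℂ), F f ∈ range f) : ∃ x, ∀ f, F f = f x := by
  have hone : F 1 = 1 := by
    obtain ⟨x, hx⟩ := hF 1
    simpa using hx.symm
  have hsq : ∀ u : C(X, ℝ), F (realToRCLike ℂ u * realToRCLike ℂ u) = F (realToRCLike ℂ u) ^ 2 := by
    intro u
    set v := realToRCLike ℂ u with hv
    obtain ⟨x, hx⟩ := hF v
    obtain ⟨x', hx'⟩ := hF (v * v)
    obtain ⟨z, hz⟩ := hF (v + Complex.I • (v * v))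
    have h1 : F v + Complex.I * F (v * v) = v z + Complex.I * (v z * v z) := by
      rw [← smul_eq_mul, ← map_smul, ← map_add, ← hz]
      simp
    rw [← hx, ← hx'] at h1 ⊢
    simp only [hv, realToRCLike_apply, mul_apply] at h1 ⊢
    have hre := congrArg Complex.re h1
    have him := congrArg Complex.im h1
    simp at hre him
    simpa [sq, hre] using congrArg Complex.ofReal him
  have hmulR : ∀ u v : C(X, ℝ), F (realToRCLike ℂ u * realToRCLike ℂ v)
      = F (realToRCLike ℂ u) * F (realToRCLike ℂ v) := by
    intro u v
    have huv := hsq (u + v)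
    have hu := hsq u
    have hv := hsq v
    have hadd : realToRCLike ℂ (u + v) = realToRCLike ℂ u + realToRCLike ℂ v := by ext; simp
    rw [hadd, add_mul, mul_add, mul_add, map_add, map_add, map_add, map_add,
      mul_comm (realToRCLike ℂ v)] at huv
    linear_combination huv / 2 - hu / 2 - hv / 2
  have hdec : ∀ f : C(X, ℂ), ∃ u v : C(X, ℝ), f = realToRCLike ℂ u + Complex.I • realToRCLike ℂ v :=
    fun f => ⟨⟨fun x => (f x).re, by fun_prop⟩, ⟨fun x => (f x).im, by fun_prop⟩, by
      ext x
      simp [Complex.ext_iff]⟩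
  have hmul : ∀ f g, F (f * g) = F f * F g := by
    intro f g
    obtain ⟨u, v, rfl⟩ := hdec f
    obtain ⟨p, q, rfl⟩ := hdec g
    simp only [add_mul, mul_add, smul_mul_assoc, mul_smul_comm, map_add, map_smul, hmulR,
      smul_eq_mul]
    ring
  obtain ⟨x, hx⟩ := (WeakDual.CharacterSpace.continuousMapEval_bijective X ℂ).2
    (WeakDual.CharacterSpace.equivAlgHom.symm (AlgHom.ofLinearMap F hone hmul))
  refine ⟨x, fun f => ?_⟩
  have := congrArg (fun c => c f) hx
  simpa using this.symm

theorem exists_eq_one_eq_zero_of_ne {X : Type*} [TopologicalSpace X] [CompactSpace X] [T2Space X]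
    (x : X) {s : Set X} (hs : s.Finite) (hx : x ∉ s) :
    ∃ f : C(X, ℂ), f x = 1 ∧ ∀ z ∈ s, f z = 0 := by
  obtain ⟨f, hf0, hf1, -⟩ := exists_continuous_zero_one_of_isClosed hs.isClosed
    (isClosed_singleton (x := x)) (disjoint_singleton_right.2 hx)
  exact ⟨realToRCLike ℂ f, by simp [hf1 (mem_singleton x)], fun z hz => by simp [hf0 hz]⟩

theorem exists_strict_peak {X : Type*} [TopologicalSpace X] [CompactSpace X] [T2Space X]
    [FirstCountableTopology X] (x : X) {s : Set X} (hs : s.Finite) (hx : x ∉ s) :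
    ∃ u : C(X, ℝ), (∀ z, u z ∈ Icc (0 : ℝ) 1) ∧ (∀ z, u z = 1 ↔ z = x) ∧
      ∀ z, u z = 0 ↔ z ∈ s := by
  have hGs : IsGδ s := hs.isGδ
  obtain ⟨f, hf1, hf0, -, hf⟩ := exists_continuous_one_zero_of_isCompact_of_isGδ
    (isCompact_singleton (x := x)) (IsGδ.singleton x) hs.isClosed (disjoint_singleton_left.2 hx)
  obtain ⟨g, hg1, hg0, -, hg⟩ := exists_continuous_one_zero_of_isCompact_of_isGδ
    hs.isCompact hGs (isClosed_singleton (x := x)) (disjoint_singleton_right.2 hx)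
  have hf1' : ∀ z, f z = 1 ↔ z = x := fun z => by
    simpa using (Set.ext_iff.1 hf1 z).symm
  have hg1' : ∀ z, g z = 1 ↔ z ∈ s := fun z => by
    simpa using (Set.ext_iff.1 hg1 z).symm
  refine ⟨⟨fun z => (f z + (1 - g z)) / 2, by fun_prop⟩, fun z => ?_, fun z => ?_, fun z => ?_⟩ <;>
    obtain ⟨h1, h2⟩ := hf z <;> obtain ⟨h3, h4⟩ := hg z
  · constructor <;> simp only [coe_mk] <;> linarith
  · simp only [coe_mk]
    refine ⟨fun h => (hf1' z).1 (by linarith), ?_⟩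
    rintro rfl
    have := hg0 (mem_singleton z)
    simp only [Pi.zero_apply] at this
    rw [(hf1' z).2 rfl, this]
    norm_num
  · simp only [coe_mk]
    refine ⟨fun h => (hg1' z).1 (by linarith), fun h => ?_⟩
    have := hf0 h
    simp only [Pi.zero_apply] at this
    rw [(hg1' z).2 h, this]
    norm_num

theorem dist_le_diam_range {Y : Type*} [TopologicalSpace Y] [CompactSpace Y] (g : C(Y, ℂ))
    (y y' : Y) : ‖g y - g y'‖ ≤ Metric.diam (range g) := by
  rw [← dist_eq_norm]
  exact Metric.dist_le_diam_of_mem (isCompact_range g.continuous).isBounded (mem_range_self y)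
    (mem_range_self y')

theorem exists_norm_sub_eq_diam_range {Y : Type*} [TopologicalSpace Y] [CompactSpace Y]
    [Nonempty Y] (g : C(Y, ℂ)) : ∃ y y', ‖g y - g y'‖ = Metric.diam (range g) := by
  obtain ⟨⟨y, y'⟩, -, hmax⟩ := isCompact_univ.exists_isMaxOn (α := ℝ) (β := Y × Y) univ_nonempty
    (f := fun p : Y × Y => ‖g p.1 - g p.2‖) (by fun_prop)
  refine ⟨y, y', (dist_le_diam_range g y y').antisymm ?_⟩
  refine Metric.diam_le_of_forall_dist_le (norm_nonneg _) ?_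
  rintro _ ⟨z, rfl⟩ _ ⟨z', rfl⟩
  rw [dist_eq_norm]
  exact hmax (mem_univ (z, z'))

theorem diam_range_realToRCLike {X : Type*} [TopologicalSpace X] [CompactSpace X] {u : C(X, ℝ)}
    (hu : ∀ z, u z ∈ Icc (0 : ℝ) 1) {x x' : X} (hx : u x = 1) (hx' : u x' = 0) :
    Metric.diam (range (realToRCLike ℂ u)) = 1 := by
  refine le_antisymm (Metric.diam_le_of_forall_dist_le zero_le_one ?_) ?_
  · rintro _ ⟨z, rfl⟩ _ ⟨z', rfl⟩
    simp only [realToRCLike_apply, Complex.coe_algebraMap, Complex.dist_eq]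
    rw [← Complex.ofReal_sub, Complex.norm_real, Real.norm_eq_abs, abs_le]
    obtain ⟨h1, h2⟩ := hu z
    obtain ⟨h3, h4⟩ := hu z'
    constructor <;> linarith
  · have := dist_le_diam_range (realToRCLike ℂ u) x x'
    simpa [hx, hx'] using this

/-- The pair `(y, y')` of `Y` corresponds to the pair `(x, x')` of `X` under `T`, with factor
`c`. -/
def PairCorr {X Y : Type*} [TopologicalSpace X] [TopologicalSpace Y]
    (T : C(X, ℂ) →ₗ[ℂ] C(Y, ℂ)) (c : ℂ) (x x' : X) (y y' : Y) : Prop :=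
  ∀ f, T f y - T f y' = c * (f x - f x')

theorem PairCorr.swap {X Y : Type*} [TopologicalSpace X] [TopologicalSpace Y]
    {T : C(X, ℂ) →ₗ[ℂ] C(Y, ℂ)} {c : ℂ} {x x' : X} {y y' : Y} (h : PairCorr T c x x' y y') :
    PairCorr T (-c) x x' y' y := fun f => by
  linear_combination -h f

theorem PairCorr.ne {X Y : Type*} [TopologicalSpace X] [CompactSpace X] [T2Space X]
    [TopologicalSpace Y] {T : C(X, ℂ) →ₗ[ℂ] C(Y, ℂ)} {c : ℂ} {x x' : X} {y y' : Y}
    (h : PairCorr T c x x' y y') (hc : ‖c‖ = 1) (hx : x ≠ x') : y ≠ y' := by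
  rintro rfl
  obtain ⟨f, h1, h0⟩ := exists_eq_one_eq_zero_of_ne x (finite_singleton x') hx
  have := h f
  rw [h1, h0 x' rfl] at this
  simp only [sub_self, sub_zero, mul_one] at this
  simp [← this] at hc

theorem eq_of_norm_le_one_of_add_eq {z w c : ℂ} (hz : ‖z‖ ≤ 1) (hw : ‖w‖ ≤ 1) (hc : ‖c‖ = 1)
    (h : z + w = 2 * c) : z = c ∧ w = c := by
  have hpar := parallelogram_law_with_norm ℝ z w
  have hs : ‖z + w‖ = 2 := by rw [h, norm_mul, hc]; simp
  have hd : ‖z - w‖ = 0 := by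
    have := norm_nonneg (z - w)
    have := norm_nonneg z
    have := norm_nonneg w
    nlinarith
  have hzw : z = w := sub_eq_zero.1 (norm_eq_zero.1 hd)
  subst hzw
  have : z = c := by linear_combination h / 2
  exact ⟨this, this⟩

theorem DiamPreserving.norm_sub_le {X Y : Type*} [TopologicalSpace X] [TopologicalSpace Y]
    [CompactSpace Y] {T : C(X, ℂ) → C(Y, ℂ)} (hT : DiamPreserving T) (f : C(X, ℂ)) (y y' : Y) :
    ‖T f y - T f y'‖ ≤ Metric.diam (range f) :=
  hT f ▸ dist_le_diam_range (T f) y y'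

theorem DiamPreserving.apply_const_eq {X Y : Type*} [TopologicalSpace X] [TopologicalSpace Y]
    [CompactSpace Y] {T : C(X, ℂ) → C(Y, ℂ)} (hT : DiamPreserving T) (c : ℂ) (y y' : Y) :
    T (const X c) y = T (const X c) y' := by
  have h := hT.norm_sub_le (const X c) y y'
  have h0 : Metric.diam (range (const X c)) = 0 :=
    Metric.diam_subsingleton (by rintro _ ⟨a, rfl⟩ _ ⟨b, rfl⟩; rfl)
  rw [h0] at h
  exact sub_eq_zero.1 (norm_le_zero_iff.1 h)

/-- Functions with values in `[0, 1]` equal to `1` at `x` and `0` at `x'` are sent by a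
diameter-preserving linear map to functions attaining their diameter at a common pair. -/
theorem DiamPreserving.exists_common_pair {X Y : Type*} [TopologicalSpace X] [CompactSpace X]
    [T2Space X] [TopologicalSpace Y] [CompactSpace Y]
    {T : C(X, ℂ) →ₗ[ℂ] C(Y, ℂ)} (hT : DiamPreserving T) {x x' : X} (hx : x ≠ x') :
    ∃ (c : ℂ) (y y' : Y), ‖c‖ = 1 ∧ ∀ u : C(X, ℝ), (∀ z, u z ∈ Icc (0 : ℝ) 1) → u x = 1 →
      u x' = 0 → T (realToRCLike ℂ u) y - T (realToRCLike ℂ u) y' = c := by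
  let I := {u : C(X, ℝ) // (∀ z, u z ∈ Icc (0 : ℝ) 1) ∧ u x = 1 ∧ u x' = 0}
  obtain ⟨u₀, h0, h1, hI⟩ := exists_continuous_zero_one_of_isClosed
    (isClosed_singleton (x := x')) (isClosed_singleton (x := x)) (by simpa using hx.symm)
  have : Nonempty I := ⟨⟨u₀, hI, by simpa using h1, by simpa using h0⟩⟩
  have hdiam : ∀ u : I, Metric.diam (range (T (realToRCLike ℂ u.1))) = 1 := fun u =>
    (hT _).trans (diam_range_realToRCLike u.2.1 u.2.2.1 u.2.2.2)
  have hle : ∀ (u : I) y y', ‖T (realToRCLike ℂ u.1) y - T (realToRCLike ℂ u.1) y'‖ ≤ 1 :=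
    fun u y y' => (dist_le_diam_range _ y y').trans_eq (hdiam u)
  have hY : Nonempty Y := by
    by_contra hY
    rw [not_nonempty_iff] at hY
    have := hdiam this.some
    rw [range_eq_empty, Metric.diam_empty] at this
    exact zero_ne_one this
  let t : I → Set (Metric.sphere (0 : ℂ) 1 × Y × Y) := fun u =>
    {p | T (realToRCLike ℂ u.1) p.2.1 - T (realToRCLike ℂ u.1) p.2.2 = p.1}
  have htcl : ∀ u, IsClosed (t u) := fun u => by
    refine isClosed_eq (Continuous.sub ?_ ?_) ?_ <;> fun_prop
  obtain ⟨⟨c, y, y'⟩, hp⟩ := IsCompact.nonempty_iInter_of_directed_nonempty_isCompact_isClosed t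
    (by
      intro u v
      let m : C(X, ℝ) := (1 / 2 : ℝ) • (u.1 + v.1)
      have hm : ∀ z, m z ∈ Icc (0 : ℝ) 1 := fun z => by
        obtain ⟨h1, h2⟩ := u.2.1 z
        obtain ⟨h3, h4⟩ := v.2.1 z
        constructor <;> simp [m] <;> linarith
      have hadd : (2 : ℂ) • realToRCLike ℂ m = realToRCLike ℂ u.1 + realToRCLike ℂ v.1 := by
        ext z
        simp [m]
        ring
      refine ⟨⟨m, hm, by norm_num [m, u.2.2.1, v.2.2.1], by simp [m, u.2.2.2, v.2.2.2]⟩, ?_⟩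
      have key : ∀ p, T (realToRCLike ℂ m) p.2.1 - T (realToRCLike ℂ m) p.2.2 = p.1 →
          p ∈ t u ∧ p ∈ t v := by
        intro p hp
        refine eq_of_norm_le_one_of_add_eq (hle u _ _) (hle v _ _) (by simp) ?_
        rw [← hp]
        have h2 : ∀ y, (2 : ℂ) * T (realToRCLike ℂ m) y
            = T (realToRCLike ℂ u.1) y + T (realToRCLike ℂ v.1) y := fun y => by
          rw [← ContinuousMap.add_apply, ← map_add, ← hadd, map_smul]
          rfl
        linear_combination -h2 p.2.1 + h2 p.2.2
      exact ⟨fun p hp => (key p hp).1, fun p hp => (key p hp).2⟩)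
    (fun u => by
      obtain ⟨y, y', h⟩ := exists_norm_sub_eq_diam_range (T (realToRCLike ℂ u.1))
      exact ⟨⟨⟨T (realToRCLike ℂ u.1) y - T (realToRCLike ℂ u.1) y',
        by rw [mem_sphere_zero_iff_norm, h, hdiam u]⟩, y, y'⟩, rfl⟩)
    (fun u => (htcl u).isCompact) htcl
  refine ⟨c, y, y', by simp, fun u hu h1 h0 => ?_⟩
  exact mem_iInter.1 hp ⟨u, hu, h1, h0⟩

theorem DiamPreserving.exists_pairCorr {X Y : Type*} [TopologicalSpace X] [CompactSpace X]
    [T2Space X] [TopologicalSpace Y] [CompactSpace Y]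
    {T : C(X, ℂ) →ₗ[ℂ] C(Y, ℂ)} (hT : DiamPreserving T) {x x' : X} (hx : x ≠ x') :
    ∃ (c : ℂ) (y y' : Y), ‖c‖ = 1 ∧ PairCorr T c x x' y y' := by
  obtain ⟨c, y, y', hc, h⟩ := hT.exists_common_pair hx
  refine ⟨c, y, y', hc, ?_⟩
  obtain ⟨u₀, hu0, hu1, hI⟩ := exists_continuous_zero_one_of_isClosed
    (isClosed_singleton (x := x')) (isClosed_singleton (x := x)) (by simpa using hx.symm)
  replace hu0 : u₀ x' = 0 := by simpa using hu0
  replace hu1 : u₀ x = 1 := by simpa using hu1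
  let F : C(X, ℂ) →ₗ[ℂ] ℂ :=
    { toFun := fun f => T f y - T f y'
      map_add' := fun f g => by simp; ring
      map_smul' := fun a f => by simp; ring }
  have hF : ∀ u : C(X, ℝ), (∀ z, u z ∈ Icc (0 : ℝ) 1) → u x = 1 → u x' = 0 →
      F (realToRCLike ℂ u) = c := h
  have hconst : ∀ a, F (const X a) = 0 := fun a => sub_eq_zero.2 (hT.apply_const_eq a y y')
  have hsmall : ∀ g : C(X, ℝ), (∀ z, g z ∈ Icc (0 : ℝ) 1) → g x = 0 → g x' = 0 →
      F (realToRCLike ℂ g) = 0 := by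
    intro g hg hgx hgx'
    let k : C(X, ℝ) := ⟨fun z => min (u₀ z) (1 - g z), by fun_prop⟩
    have hk : F (realToRCLike ℂ k) = c := hF k
      (fun z => ⟨le_min (hI z).1 (by linarith [(hg z).2]), (min_le_left _ _).trans (hI z).2⟩)
      (by simp [k, hu1, hgx]) (by simp [k, hu0, hgx'])
    have hkg : F (realToRCLike ℂ (k + g)) = c := hF (k + g)
      (fun z => by
        have h1 : 0 ≤ k z := le_min (hI z).1 (by linarith [(hg z).2])
        have h2 : k z ≤ 1 - g z := min_le_right _ _
        have h3 := (hg z).1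
        constructor <;> rw [ContinuousMap.add_apply] <;> linarith)
      (by simp [k, hu1, hgx]) (by simp [k, hu0, hgx'])
    have hadd : realToRCLike ℂ (k + g) = realToRCLike ℂ k + realToRCLike ℂ g := by ext; simp
    rw [hadd, map_add, hk] at hkg
    simpa using hkg
  have hnonneg : ∀ g : C(X, ℝ), (∀ z, 0 ≤ g z) → g x = 0 → g x' = 0 →
      F (realToRCLike ℂ g) = 0 := by
    intro g hg hgx hgx'
    have hM : 0 < ‖g‖ + 1 := by positivity
    have hs := hsmall ⟨fun z => g z / (‖g‖ + 1), by fun_prop⟩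
      (fun z => ⟨div_nonneg (hg z) hM.le, by
        rw [coe_mk, div_le_one hM]
        have := (le_abs_self _).trans (g.norm_coe_le_norm z)
        linarith⟩) (by simp [hgx]) (by simp [hgx'])
    have hg' : realToRCLike ℂ g = ((‖g‖ + 1 : ℝ) : ℂ) •
        realToRCLike ℂ (⟨fun z => g z / (‖g‖ + 1), by fun_prop⟩ : C(X, ℝ)) := by
      ext z
      simp only [realToRCLike_apply, Complex.coe_algebraMap, coe_smul, Pi.smul_apply, coe_mk,
        smul_eq_mul]
      rw [← Complex.ofReal_mul, mul_div_cancel₀ _ hM.ne']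
    rw [hg', map_smul, hs, smul_zero]
  have hvanish : ∀ g : C(X, ℝ), g x = 0 → g x' = 0 → F (realToRCLike ℂ g) = 0 := by
    intro g hgx hgx'
    have hp := hnonneg ⟨fun z => max (g z) 0, by fun_prop⟩ (fun z => le_max_right _ _)
      (by simp [hgx]) (by simp [hgx'])
    have hn := hnonneg ⟨fun z => max (-g z) 0, by fun_prop⟩ (fun z => le_max_right _ _)
      (by simp [hgx]) (by simp [hgx'])
    have hg : realToRCLike ℂ g = realToRCLike ℂ (⟨fun z => max (g z) 0, by fun_prop⟩ : C(X, ℝ))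
        - realToRCLike ℂ (⟨fun z => max (-g z) 0, by fun_prop⟩ : C(X, ℝ)) := by
      ext z
      simp only [realToRCLike_apply, Complex.coe_algebraMap, ContinuousMap.sub_apply, coe_mk]
      rw [← Complex.ofReal_sub, max_zero_sub_max_neg_zero_eq_self]
    rw [hg, map_sub, hp, hn, sub_zero]
  have hreal : ∀ u : C(X, ℝ), F (realToRCLike ℂ u) = c * (u x - u x') := by
    intro u
    have hg := hvanish ⟨fun z => u z - u x' - (u x - u x') * u₀ z, by fun_prop⟩
      (by simp [hu1]) (by simp [hu0])
    have hu : realToRCLike ℂ u = realToRCLike ℂ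
        (⟨fun z => u z - u x' - (u x - u x') * u₀ z, by fun_prop⟩ : C(X, ℝ))
        + const X (u x' : ℂ) + (u x - u x' : ℂ) • realToRCLike ℂ u₀ := by
      ext z
      simp
      ring
    rw [hu, map_add, map_add, map_smul, hg, hconst, hF u₀ hI hu1 hu0, smul_eq_mul]
    ring
  intro f
  change F f = _
  have hf : f = realToRCLike ℂ (⟨fun z => (f z).re, by fun_prop⟩ : C(X, ℝ))
      + Complex.I • realToRCLike ℂ (⟨fun z => (f z).im, by fun_prop⟩ : C(X, ℝ)) := by
    ext z
    simp [Complex.ext_iff]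
  have hfx : ∀ z, f z = (f z).re + Complex.I * (f z).im := fun z => by
    rw [mul_comm, Complex.re_add_im]
  rw [hf, map_add, map_smul, hreal, hreal, ← hf, hfx x, hfx x']
  simp
  ring

theorem PairCorr.factor_eq {X Y : Type*} [TopologicalSpace X] [CompactSpace X] [T2Space X]
    [TopologicalSpace Y] {T : C(X, ℂ) →ₗ[ℂ] C(Y, ℂ)} {c c' : ℂ} {x x' : X} {y y' : Y}
    (h : PairCorr T c x x' y y') (h' : PairCorr T c' x x' y y') (hx : x ≠ x') : c = c' := by
  obtain ⟨f, h1, h0⟩ := exists_eq_one_eq_zero_of_ne x (finite_singleton x') hx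
  have := (h f).symm.trans (h' f)
  simpa [h1, h0 x' rfl] using this

theorem DiamPreserving.exists_section {X Y : Type*} [TopologicalSpace X] [CompactSpace X]
    [T2Space X] [TopologicalSpace Y] [CompactSpace Y] {T : C(X, ℂ) →ₗ[ℂ] C(Y, ℂ)}
    (hT : DiamPreserving T) [Infinite X]
    (htriple : ∀ x₁ x₂ x₃ : X, x₁ ≠ x₂ → x₁ ≠ x₃ → x₂ ≠ x₃ →
      ∃ (c : ℂ) (a b d : Y), ‖c‖ = 1 ∧ PairCorr T c x₁ x₂ a b ∧ PairCorr T c x₁ x₃ a d)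
    (huniq : ∀ (x x' : X) (c c' : ℂ) (a b a' b' : Y), x ≠ x' → ‖c‖ = 1 → ‖c'‖ = 1 →
      PairCorr T c x x' a b → PairCorr T c' x x' a' b' → (a = a' ∧ b = b') ∨ (a = b' ∧ b = a')) :
    ∃ (c : ℂ) (θ : X → Y) (L : C(X, ℂ) →ₗ[ℂ] ℂ), ‖c‖ = 1 ∧
      ∀ f x, T f (θ x) = c * f x + L f := by
  classical
  obtain ⟨x₁⟩ : Nonempty X := inferInstance
  obtain ⟨x₂, h₂⟩ := Infinite.exists_notMem_finset ({x₁} : Finset X)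
  obtain ⟨x₃, h₃⟩ := Infinite.exists_notMem_finset ({x₁, x₂} : Finset X)
  simp only [Finset.mem_singleton] at h₂
  simp only [Finset.mem_insert, Finset.mem_singleton, not_or] at h₃
  obtain ⟨c, a, b, d, hc, hab, had⟩ := htriple x₁ x₂ x₃ (Ne.symm h₂) (Ne.symm h₃.1) (Ne.symm h₃.2)
  have key : ∀ x, ∃ y, PairCorr T c x₁ x a y := by
    intro x
    by_cases hx1 : x = x₁
    · exact ⟨a, fun f => by simp [hx1]⟩
    by_cases hx2 : x = x₂
    · exact ⟨b, hx2 ▸ hab⟩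
    by_cases hx3 : x = x₃
    · exact ⟨d, hx3 ▸ had⟩
    obtain ⟨c', a', b', d', hc', hab', had'⟩ :=
      htriple x₁ x₂ x (Ne.symm h₂) (Ne.symm hx1) (Ne.symm hx2)
    rcases huniq x₁ x₂ c c' a b a' b' (Ne.symm h₂) hc hc' hab hab' with ⟨rfl, rfl⟩ | ⟨rfl, rfl⟩
    · rw [hab.factor_eq hab' (Ne.symm h₂)]
      exact ⟨d', had'⟩
    · exfalso
      have hcc := hab.factor_eq hab'.swap (Ne.symm h₂)
      have hfin : ∀ s t : X, IsClosed ({s, t} : Set X) := fun s t => (toFinite {s, t}).isClosed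
      obtain ⟨u, hu0, hu1, hu⟩ := exists_continuous_zero_one_of_isClosed (hfin x₁ x₂) (hfin x₃ x)
        (by
          rw [Set.disjoint_left]
          rintro z (rfl | rfl) (h | h)
          · exact h₃.1 h.symm
          · exact hx1 (Eq.symm h)
          · exact h₃.2 h.symm
          · exact hx2 (Eq.symm h))
      have e1 : u x₁ = 0 := hu0 (by simp)
      have e2 : u x₂ = 0 := hu0 (by simp)
      have e3 : u x₃ = 1 := hu1 (by simp)
      have e4 : u x = 1 := hu1 (by simp)
      have hle := hT.norm_sub_le (realToRCLike ℂ u) d d'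
      rw [diam_range_realToRCLike hu e3 e1] at hle
      have h12 := hab (realToRCLike ℂ u)
      have h13 := had (realToRCLike ℂ u)
      have h14 := had' (realToRCLike ℂ u)
      simp only [realToRCLike_apply, e1, e2, e3, e4] at h12 h13 h14
      have h2 : T (realToRCLike ℂ u) d - T (realToRCLike ℂ u) d' = 2 * c := by
        simp at h12 h13 h14
        linear_combination h14 - h13 + h12 - hcc
      rw [h2, norm_mul, hc] at hle
      norm_num at hle
  choose θ hθ using key
  refine ⟨c, θ, ⟨⟨fun f => T f a - c * f x₁, fun f g => ?_⟩, fun r f => ?_⟩, hc, fun f x => ?_⟩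
  · simp
    ring
  · simp
    ring
  · have := hθ x f
    simp only [LinearMap.coe_mk, AddHom.coe_mk]
    linear_combination -this

theorem PairCorr.eq_or_eq_of_surjective {X Y : Type*} [TopologicalSpace X] [TopologicalSpace Y]
    [CompactSpace Y] [T2Space Y] {T : C(X, ℂ) →ₗ[ℂ] C(Y, ℂ)} (hT : Function.Surjective T)
    {x x' : X} {c c' : ℂ} {a b a' b' : Y} (hc' : ‖c'‖ = 1) (hab : a ≠ b)
    (h : PairCorr T c x x' a b) (h' : PairCorr T c' x x' a' b') : a = a' ∨ a = b' := by
  by_contra! hne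
  obtain ⟨g, h1, h0⟩ := exists_eq_one_eq_zero_of_ne a (toFinite {b, a', b'})
    (by simp [hab, hne.1, hne.2])
  obtain ⟨f, rfl⟩ := hT g
  have e := h f
  have e' := h' f
  rw [h1, h0 b (by simp)] at e
  rw [h0 a' (by simp), h0 b' (by simp)] at e'
  have : c' = 0 := by linear_combination c' * e - c * e'
  simp [this] at hc'

/-- Two pairs of `Y` corresponding to pairs `(x₁, x₂)` and `(x₁, x₃)` under a surjection and with
the same first point have the same factor. -/
theorem PairCorr.factor_eq_of_surjective {X Y : Type*} [TopologicalSpace X] [CompactSpace X]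
    [T2Space X] [TopologicalSpace Y] [CompactSpace Y] [T2Space Y] {T : C(X, ℂ) →ₗ[ℂ] C(Y, ℂ)}
    (hT : Function.Surjective T) {x₁ x₂ x₃ : X} {α β γ : ℂ} {a b d p q : Y}
    (h₁₂ : x₁ ≠ x₂) (h₁₃ : x₁ ≠ x₃) (h₂₃ : x₂ ≠ x₃) (hα : ‖α‖ = 1) (hβ : ‖β‖ = 1) (hγ : ‖γ‖ = 1)
    (hab : PairCorr T α x₁ x₂ a b) (had : PairCorr T β x₁ x₃ a d)
    (hpq : PairCorr T γ x₂ x₃ p q) : α = β := by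
  have hα0 : α ≠ 0 := norm_ne_zero_iff.1 (by simp [hα])
  have hβ0 : β ≠ 0 := norm_ne_zero_iff.1 (by simp [hβ])
  have hγ0 : γ ≠ 0 := norm_ne_zero_iff.1 (by simp [hγ])
  have hrel : ∀ g : C(Y, ℂ), β * γ * (g a - g b) - α * γ * (g a - g d)
      + α * β * (g p - g q) = 0 := by
    intro g
    obtain ⟨f, rfl⟩ := hT g
    linear_combination β * γ * hab f - α * γ * had f + α * β * hpq f
  have hab' := hab.ne hα h₁₂
  have had' := had.ne hβ h₁₃
  have hbd : b ≠ d := by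
    rintro rfl
    obtain ⟨f, h1, h0⟩ := exists_eq_one_eq_zero_of_ne x₂ (toFinite {x₁, x₃})
      (by simp [h₁₂.symm, h₂₃])
    have e := hab f
    have e' := had f
    rw [h1, h0 x₁ (by simp)] at e
    rw [h0 x₁ (by simp), h0 x₃ (by simp)] at e'
    exact hα0 (by linear_combination e - e')
  have hb : b = p ∨ b = q := by
    by_contra! hne
    obtain ⟨g, h1, h0⟩ := exists_eq_one_eq_zero_of_ne b (toFinite {a, d, p, q})
      (by simp [hab'.symm, hbd, hne.1, hne.2])
    have := hrel g
    rw [h1, h0 a (by simp), h0 d (by simp), h0 p (by simp), h0 q (by simp)] at this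
    simp [hβ0, hγ0] at this
  have hd : d = p ∨ d = q := by
    by_contra! hne
    obtain ⟨g, h1, h0⟩ := exists_eq_one_eq_zero_of_ne d (toFinite {a, b, p, q})
      (by simp [had'.symm, hbd.symm, hne.1, hne.2])
    have := hrel g
    rw [h1, h0 a (by simp), h0 b (by simp), h0 p (by simp), h0 q (by simp)] at this
    simp [hα0, hγ0] at this
  have hap : a ≠ p ∧ a ≠ q := by grind
  obtain ⟨g, h1, h0⟩ := exists_eq_one_eq_zero_of_ne a (toFinite {b, d, p, q})
    (by simp [hab', had', hap.1, hap.2])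
  have := hrel g
  rw [h1, h0 b (by simp), h0 d (by simp), h0 p (by simp), h0 q (by simp)] at this
  refine mul_left_cancel₀ hγ0 ?_
  linear_combination -this

theorem DiamPreserving.exists_triple_of_surjective {X Y : Type*} [TopologicalSpace X]
    [CompactSpace X] [T2Space X] [TopologicalSpace Y] [CompactSpace Y] [T2Space Y]
    {T : C(X, ℂ) →ₗ[ℂ] C(Y, ℂ)} (hT : DiamPreserving T) (hs : Function.Surjective T)
    {x₁ x₂ x₃ : X} (h₁₂ : x₁ ≠ x₂) (h₁₃ : x₁ ≠ x₃) (h₂₃ : x₂ ≠ x₃) :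
    ∃ (c : ℂ) (a b d : Y), ‖c‖ = 1 ∧ PairCorr T c x₁ x₂ a b ∧ PairCorr T c x₁ x₃ a d := by
  obtain ⟨α, a, b, hα, hab⟩ := hT.exists_pairCorr h₁₂
  obtain ⟨β, a', d, hβ, had⟩ := hT.exists_pairCorr h₁₃
  obtain ⟨γ, p, q, hγ, hpq⟩ := hT.exists_pairCorr h₂₃
  have main : ∀ {α β : ℂ} {a b d : Y}, ‖α‖ = 1 → ‖β‖ = 1 → PairCorr T α x₁ x₂ a b →
      PairCorr T β x₁ x₃ a d → ∃ (c : ℂ) (a b d : Y), ‖c‖ = 1 ∧ PairCorr T c x₁ x₂ a b ∧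
        PairCorr T c x₁ x₃ a d := by
    intro α β a b d hα hβ hab had
    have := hab.factor_eq_of_surjective hs h₁₂ h₁₃ h₂₃ hα hβ hγ had hpq
    exact ⟨α, a, b, d, hα, hab, this ▸ had⟩
  have hnα : ‖-α‖ = 1 := by rwa [norm_neg]
  have hnβ : ‖-β‖ = 1 := by rwa [norm_neg]
  by_cases h1 : a = a'
  · exact main hα hβ hab (h1 ▸ had)
  by_cases h2 : a = d
  · exact main hα hnβ hab (h2 ▸ had.swap)
  by_cases h3 : b = a'
  · exact main hnα hβ hab.swap (h3 ▸ had)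
  by_cases h4 : b = d
  · exact main hnα hnβ hab.swap (h4 ▸ had.swap)
  exfalso
  have hα0 : α ≠ 0 := norm_ne_zero_iff.1 (by simp [hα])
  have hβ0 : β ≠ 0 := norm_ne_zero_iff.1 (by simp [hβ])
  have hγ0 : γ ≠ 0 := norm_ne_zero_iff.1 (by simp [hγ])
  have hrel : ∀ g : C(Y, ℂ), β * γ * (g a - g b) - α * γ * (g a' - g d)
      + α * β * (g p - g q) = 0 := by
    intro g
    obtain ⟨f, rfl⟩ := hs g
    linear_combination β * γ * hab f - α * γ * had f + α * β * hpq f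
  have hab' := hab.ne hα h₁₂
  have had' := had.ne hβ h₁₃
  have ha : a = p ∨ a = q := by
    by_contra! hne
    obtain ⟨g, e1, e0⟩ := exists_eq_one_eq_zero_of_ne a (toFinite {b, a', d, p, q})
      (by simp [hab', h1, h2, hne.1, hne.2])
    have := hrel g
    rw [e1, e0 b (by simp), e0 a' (by simp), e0 d (by simp), e0 p (by simp), e0 q (by simp)] at this
    simp [hβ0, hγ0] at this
  have hb : b = p ∨ b = q := by
    by_contra! hne
    obtain ⟨g, e1, e0⟩ := exists_eq_one_eq_zero_of_ne b (toFinite {a, a', d, p, q})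
      (by simp [hab'.symm, h3, h4, hne.1, hne.2])
    have := hrel g
    rw [e1, e0 a (by simp), e0 a' (by simp), e0 d (by simp), e0 p (by simp), e0 q (by simp)] at this
    simp [hβ0, hγ0] at this
  have hd : d = p ∨ d = q := by
    by_contra! hne
    obtain ⟨g, e1, e0⟩ := exists_eq_one_eq_zero_of_ne d (toFinite {a, b, a', p, q})
      (by simp [had'.symm, Ne.symm h2, Ne.symm h4, hne.1, hne.2])
    have := hrel g
    rw [e1, e0 a (by simp), e0 b (by simp), e0 a' (by simp), e0 p (by simp), e0 q (by simp)] at this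
    simp [hα0, hγ0] at this
  grind

theorem DiamPreserving.exists_section_of_surjective {X Y : Type*} [TopologicalSpace X]
    [CompactSpace X] [T2Space X] [TopologicalSpace Y] [CompactSpace Y] [T2Space Y]
    {T : C(X, ℂ) →ₗ[ℂ] C(Y, ℂ)} (hT : DiamPreserving T) (hs : Function.Surjective T) [Infinite X] :
    ∃ (c : ℂ) (θ : X → Y) (L : C(X, ℂ) →ₗ[ℂ] ℂ), ‖c‖ = 1 ∧
      ∀ f x, T f (θ x) = c * f x + L f := by
  refine hT.exists_section (fun x₁ x₂ x₃ => hT.exists_triple_of_surjective hs) ?_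
  intro x x' c c' a b a' b' hx hc hc' h h'
  have hab := h.ne hc hx
  have e1 := h.eq_or_eq_of_surjective hs hc' hab h'
  have e2 := h.swap.eq_or_eq_of_surjective hs hc' hab.symm h'
  grind

/-- The form of diameter-preserving linear bijections. -/
theorem DiamPreserving.exists_injective_eq_comp_add {X Y : Type*} [TopologicalSpace X]
    [CompactSpace X] [T2Space X] [TopologicalSpace Y] [CompactSpace Y] [T2Space Y] [Infinite Y]
    {S : C(X, ℂ) →ₗ[ℂ] C(Y, ℂ)} (hS : DiamPreserving S) (hb : Function.Bijective S) :
    ∃ (c : ℂ) (ψ : Y → X) (L : C(X, ℂ) → ℂ), ‖c‖ = 1 ∧ Function.Injective ψ ∧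
      ∀ f y, S f y = c * f (ψ y) + L f := by
  let e := LinearEquiv.ofBijective S hb
  have heS : ∀ f, e f = S f := fun f => rfl
  have he : DiamPreserving (e.symm : C(Y, ℂ) →ₗ[ℂ] C(X, ℂ)) := fun g => by
    obtain ⟨f, rfl⟩ := e.surjective g
    rw [LinearEquiv.coe_coe, e.symm_apply_apply, heS, hS f]
  obtain ⟨c, ψ, L, hc, h⟩ := he.exists_section_of_surjective e.symm.surjective
  have hc0 : c ≠ 0 := norm_ne_zero_iff.1 (by simp [hc])
  have hform : ∀ f y, S f y = c⁻¹ * f (ψ y) + -(c⁻¹ * L (S f)) := by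
    intro f y
    have := h (S f) y
    rw [LinearEquiv.coe_coe, ← heS, e.symm_apply_apply, heS] at this
    rw [this]
    field_simp
    ring
  refine ⟨c⁻¹, ψ, fun f => -(c⁻¹ * L (S f)), by simp [hc], fun y y' hy => ?_, hform⟩
  by_contra hne
  obtain ⟨g, h1, h0⟩ := exists_eq_one_eq_zero_of_ne y (finite_singleton y') hne
  obtain ⟨f, rfl⟩ := hb.2 g
  have := hform f y'
  rw [← hy, ← hform f y, h1, h0 y' rfl] at this
  exact zero_ne_one this

theorem eq_one_eq_zero_of_mul_sub_eq {m c : ℂ} (hm : ‖m‖ = 1) (hc : ‖c‖ = 1) {s t : ℝ}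
    (hs : s ∈ Icc (0 : ℝ) 1) (ht : t ∈ Icc (0 : ℝ) 1) (h : m * (s - t : ℂ) = c) :
    (s = 1 ∧ t = 0 ∧ m = c) ∨ (s = 0 ∧ t = 1 ∧ m = -c) := by
  have habs : |s - t| = 1 := by
    have := congrArg norm h
    rwa [norm_mul, hm, hc, one_mul, ← Complex.ofReal_sub, Complex.norm_real,
      Real.norm_eq_abs] at this
  obtain ⟨h1, h2⟩ := hs
  obtain ⟨h3, h4⟩ := ht
  rcases eq_or_eq_neg_of_abs_eq habs with h' | h'
  · have e1 : s = 1 := by linarith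
    have e2 : t = 0 := by linarith
    refine Or.inl ⟨e1, e2, ?_⟩
    simpa [e1, e2] using h
  · have e1 : s = 0 := by linarith
    have e2 : t = 1 := by linarith
    refine Or.inr ⟨e1, e2, ?_⟩
    simp [e1, e2] at h
    simp [← h]

/-- At each function, `T` is a unimodular multiple of composition with an injective map, up to an
additive constant. -/
def LocallyInjectiveComp {X Y : Type*} [TopologicalSpace X] [TopologicalSpace Y]
    (T : C(X, ℂ) →ₗ[ℂ] C(Y, ℂ)) : Prop :=
  ∀ f, ∃ (m : ℂ) (ψ : Y → X) (b : ℂ), ‖m‖ = 1 ∧ Function.Injective ψ ∧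
    ∀ y, T f y = m * f (ψ y) + b

theorem LocallyInjectiveComp.pair_unique {X Y : Type*} [TopologicalSpace X] [CompactSpace X]
    [T2Space X] [FirstCountableTopology X] [TopologicalSpace Y] {T : C(X, ℂ) →ₗ[ℂ] C(Y, ℂ)}
    (hT : LocallyInjectiveComp T) {x x' : X} {c c' : ℂ} {a b a' b' : Y} (hx : x ≠ x')
    (hc : ‖c‖ = 1) (hc' : ‖c'‖ = 1) (h : PairCorr T c x x' a b) (h' : PairCorr T c' x x' a' b') :
    (a = a' ∧ b = b') ∨ (a = b' ∧ b = a') := by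
  obtain ⟨u, hu, hu1, hu0⟩ := exists_strict_peak x (finite_singleton x') hx
  obtain ⟨m, ψ, r, hm, hψ, hform⟩ := hT (realToRCLike ℂ u)
  have key : ∀ {c : ℂ} {a b : Y}, ‖c‖ = 1 → PairCorr T c x x' a b →
      (ψ a = x ∧ ψ b = x') ∨ (ψ a = x' ∧ ψ b = x) := by
    intro c a b hc h
    have e := h (realToRCLike ℂ u)
    rw [hform, hform] at e
    simp only [realToRCLike_apply, (hu1 x).2 rfl, (hu0 x').2 rfl] at e
    rcases eq_one_eq_zero_of_mul_sub_eq hm hc (hu (ψ a)) (hu (ψ b))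
      (by simp at e; linear_combination e) with ⟨h1, h2, -⟩ | ⟨h1, h2, -⟩
    · exact Or.inl ⟨(hu1 _).1 h1, (hu0 _).1 h2⟩
    · exact Or.inr ⟨(hu0 _).1 h1, (hu1 _).1 h2⟩
  have hinj : ∀ {s t : Y}, ψ s = ψ t → s = t := fun h => hψ h
  rcases key hc h with ⟨h1, h2⟩ | ⟨h1, h2⟩ <;> rcases key hc' h' with ⟨h3, h4⟩ | ⟨h3, h4⟩
  · exact Or.inl ⟨hinj (h1.trans h3.symm), hinj (h2.trans h4.symm)⟩
  · exact Or.inr ⟨hinj (h1.trans h4.symm), hinj (h2.trans h3.symm)⟩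
  · exact Or.inr ⟨hinj (h1.trans h4.symm), hinj (h2.trans h3.symm)⟩
  · exact Or.inl ⟨hinj (h1.trans h3.symm), hinj (h2.trans h4.symm)⟩

theorem LocallyInjectiveComp.exists_triple {X Y : Type*} [TopologicalSpace X] [CompactSpace X]
    [T2Space X] [FirstCountableTopology X] [TopologicalSpace Y] [CompactSpace Y]
    {T : C(X, ℂ) →ₗ[ℂ] C(Y, ℂ)} (hT : LocallyInjectiveComp T) (hd : DiamPreserving T)
    {x₁ x₂ x₃ : X} (h₁₂ : x₁ ≠ x₂) (h₁₃ : x₁ ≠ x₃) :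
    ∃ (c : ℂ) (a b d : Y), ‖c‖ = 1 ∧ PairCorr T c x₁ x₂ a b ∧ PairCorr T c x₁ x₃ a d := by
  obtain ⟨u, hu, hu1, hu0⟩ := exists_strict_peak x₁ (toFinite {x₂, x₃}) (by simp [h₁₂, h₁₃])
  obtain ⟨m, ψ, r, hm, hψ, hform⟩ := hT (realToRCLike ℂ u)
  have key : ∀ x, x₁ ≠ x → u x = 0 → ∃ a b, ψ a = x₁ ∧ PairCorr T m x₁ x a b := by
    intro x hx hux
    obtain ⟨c, a, b, hc, h⟩ := hd.exists_pairCorr hx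
    have e := h (realToRCLike ℂ u)
    rw [hform, hform] at e
    simp only [realToRCLike_apply, (hu1 x₁).2 rfl, hux] at e
    rcases eq_one_eq_zero_of_mul_sub_eq hm hc (hu (ψ a)) (hu (ψ b))
      (by simp at e; linear_combination e) with ⟨h1, -, h2⟩ | ⟨-, h1, h2⟩
    · exact ⟨a, b, (hu1 _).1 h1, h2 ▸ h⟩
    · exact ⟨b, a, (hu1 _).1 h1, h2 ▸ h.swap⟩
  obtain ⟨a, b, ha, hab⟩ := key x₂ h₁₂ ((hu0 x₂).2 (by simp))
  obtain ⟨a', d, ha', had⟩ := key x₃ h₁₃ ((hu0 x₃).2 (by simp))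
  obtain rfl := hψ (ha.trans ha'.symm)
  exact ⟨m, a, b, d, hm, hab, had⟩

theorem continuous_of_forall_continuous_comp {X Y : Type*} [TopologicalSpace X] [CompactSpace X]
    [T2Space X] [TopologicalSpace Y] {φ : Y → X}
    (h : ∀ f : C(X, ℂ), Continuous fun y => f (φ y)) : Continuous φ := by
  refine continuous_def.2 fun U hU => isOpen_iff_mem_nhds.2 fun y hy => ?_
  obtain ⟨u, hu0, hu1, -⟩ := exists_continuous_zero_one_of_isClosed hU.isClosed_compl
    (isClosed_singleton (x := φ y)) (by simpa using hy)
  have hopen : IsOpen {z | realToRCLike ℂ u (φ z) ≠ 0} := isOpen_ne_fun (h _) continuous_const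
  have hmem : y ∈ {z | realToRCLike ℂ u (φ z) ≠ 0} := by simp [hu1 (mem_singleton (φ y))]
  refine Filter.mem_of_superset (hopen.mem_nhds hmem) fun z hz => ?_
  by_contra hzU
  exact hz (by simp [hu0 hzU])

/-- A diameter-preserving map which is locally composition with injective maps is, up to a linear
functional, a unimodular multiple of a composition operator. -/
theorem LocallyInjectiveComp.exists_eq_comp_add {X Y : Type*} [TopologicalSpace X]
    [CompactSpace X] [T2Space X] [FirstCountableTopology X] [Infinite X] [TopologicalSpace Y]
    [CompactSpace Y] {T : C(X, ℂ) →ₗ[ℂ] C(Y, ℂ)} (hT : LocallyInjectiveComp T)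
    (hd : DiamPreserving T) :
    ∃ (c : ℂ) (θ : X → Y) (φ : Y → X) (L : C(X, ℂ) →ₗ[ℂ] ℂ), ‖c‖ = 1 ∧
      (∀ x, φ (θ x) = x) ∧ ∀ f y, T f y = c * f (φ y) + L f := by
  obtain ⟨c, θ, L, hc, hθ⟩ := hd.exists_section
    (fun x₁ x₂ x₃ h₁₂ h₁₃ _ => hT.exists_triple hd h₁₂ h₁₃)
    (fun x x' c c' a b a' b' => hT.pair_unique)
  have hc0 : c ≠ 0 := norm_ne_zero_iff.1 (by simp [hc])
  have hrange : ∀ y (f : C(X, ℂ)), c⁻¹ * (T f y - L f) ∈ range f := by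
    intro y f
    obtain ⟨m, ψ, b, hm, -, hform⟩ := hT f
    have hm0 : m ≠ 0 := norm_ne_zero_iff.1 (by simp [hm])
    let j : ℂ → ℂ := fun z => m⁻¹ * (c * z + L f - b)
    have hj : Isometry j := Isometry.of_dist_eq fun z w => by
      rw [dist_eq_norm, dist_eq_norm, show j z - j w = m⁻¹ * (c * (z - w)) by simp only [j]; ring]
      simp [hm, hc]
    have hmaps : MapsTo j (range f) (range f) := by
      rintro _ ⟨x, rfl⟩
      refine ⟨ψ (θ x), ?_⟩
      have := (hθ f x).symm.trans (hform (θ x))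
      simp only [j]
      rw [this]
      field_simp
      ring
    obtain ⟨z, hz, hzj⟩ :=
      (isCompact_range f.continuous).subset_image_of_isometry hj hmaps (mem_range_self (ψ y))
    have : c⁻¹ * (T f y - L f) = z := by
      rw [hform, ← hzj]
      simp only [j]
      field_simp
      ring
    rwa [this]
  have heval : ∀ y, ∃ x, ∀ f : C(X, ℂ), c⁻¹ * (T f y - L f) = f x := fun y =>
    exists_eval_eq_of_mem_range
      { toFun := fun f => c⁻¹ * (T f y - L f)
        map_add' := fun f g => by simp; ring
        map_smul' := fun a f => by simp; ring } (hrange y)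
  choose φ hφ using heval
  have hform : ∀ f y, T f y = c * f (φ y) + L f := fun f y => by
    rw [← hφ]
    field_simp
    ring
  refine ⟨c, θ, φ, L, hc, fun x => ?_, hform⟩
  by_contra hne
  obtain ⟨f, h1, h0⟩ := exists_eq_one_eq_zero_of_ne x (finite_singleton (φ (θ x))) (Ne.symm hne)
  have := (hθ f x).symm.trans (hform f (θ x))
  rw [h1, h0 _ rfl] at this
  exact hc0 (by linear_combination this)

theorem LocallyInjectiveComp.surjective {X Y : Type*} [TopologicalSpace X]
    [CompactSpace X] [T2Space X] [FirstCountableTopology X] [Infinite X] [TopologicalSpace Y]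
    [CompactSpace Y] [T2Space Y] {T : C(X, ℂ) →ₗ[ℂ] C(Y, ℂ)} (hT : LocallyInjectiveComp T)
    (hd : DiamPreserving T) (hinj : Function.Injective T) : Function.Surjective T := by
  obtain ⟨c, θ, φ, L, hc, hφθ, hform⟩ := hT.exists_eq_comp_add hd
  have hc0 : c ≠ 0 := norm_ne_zero_iff.1 (by simp [hc])
  have hφc : Continuous φ := continuous_of_forall_continuous_comp fun f => by
    have : (fun y => f (φ y)) = fun y => c⁻¹ * (T f y - L f) := funext fun y => by
      rw [hform]
      field_simp
      ring
    rw [this]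
    fun_prop
  have hφi : Function.Injective φ := by
    intro y y' hy
    obtain ⟨x', hx'⟩ := exists_ne (φ y)
    obtain ⟨u, hu, hu1, hu0⟩ := exists_strict_peak (φ y) (finite_singleton x') hx'.symm
    obtain ⟨m, ψ, b, hm, hψ, hloc⟩ := hT (realToRCLike ℂ u)
    have key : ∀ z, φ z = φ y →
        (ψ z = φ y ∧ ψ (θ x') = x') ∨ (ψ z = x' ∧ ψ (θ x') = φ y) := by
      intro z hz
      have e : T (realToRCLike ℂ u) z - T (realToRCLike ℂ u) (θ x') = c := by
        rw [hform, hform, hφθ, hz]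
        simp [(hu1 _).2 rfl, (hu0 x').2 rfl]
      rw [hloc, hloc] at e
      simp only [realToRCLike_apply] at e
      rcases eq_one_eq_zero_of_mul_sub_eq hm hc (hu (ψ z)) (hu (ψ (θ x')))
        (by simp at e; linear_combination e) with ⟨h1, h2, -⟩ | ⟨h1, h2, -⟩
      · exact Or.inl ⟨(hu1 _).1 h1, (hu0 _).1 h2⟩
      · exact Or.inr ⟨(hu0 _).1 h1, (hu1 _).1 h2⟩
    have hyy : ψ y = ψ y' := by
      have := key y rfl
      have := key y' hy.symm
      grind
    exact hψ hyy
  let e : Y ≃ X := ⟨φ, θ, fun y => hφi (hφθ _), hφθ⟩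
  let φh : Y ≃ₜ X := hφc.homeoOfEquivCompactToT2 (f := e)
  have hL : c + L 1 ≠ 0 := by
    intro h0
    have h1 : T 1 = 0 := by
      ext y
      simp [hform, h0]
    have h2 : (1 : C(X, ℂ)) = 0 := hinj (h1.trans (map_zero T).symm)
    obtain ⟨x⟩ : Nonempty X := inferInstance
    exact one_ne_zero (congrArg (fun f : C(X, ℂ) => f x) h2)
  intro g
  let f : C(X, ℂ) := c⁻¹ • g.comp φh.symm
  refine ⟨f - (L f / (c + L 1)) • 1, ?_⟩
  ext y
  have hy : φh.symm (φ y) = y := φh.symm_apply_apply y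
  rw [hform, map_sub, map_smul]
  simp [f, hy]
  field_simp
  ring

theorem finite_of_finiteDimensional_continuousMap {X : Type*} [TopologicalSpace X]
    [CompactSpace X] [T2Space X] [FiniteDimensional ℂ C(X, ℂ)] : Finite X := by
  have hli : LinearIndependent ℂ fun x : X =>
      (ContinuousMap.evalCLM ℂ x : C(X, ℂ) →L[ℂ] ℂ).toLinearMap := by
    rw [linearIndependent_iff']
    intro s g hg x hx
    obtain ⟨f, h1, h0⟩ := exists_eq_one_eq_zero_of_ne x
      ((s.finite_toSet).subset (sdiff_subset (t := {x}))) (by simp)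
    have := LinearMap.congr_fun hg f
    simp only [LinearMap.sum_apply, LinearMap.smul_apply, ContinuousLinearMap.coe_coe,
      evalCLM_apply, smul_eq_mul, LinearMap.zero_apply] at this
    rw [Finset.sum_eq_single_of_mem x hx fun z hz hzx => by rw [h0 z ⟨hz, hzx⟩, mul_zero], h1,
      mul_one] at this
    exact this
  have : FiniteDimensional ℂ (C(X, ℂ) →ₗ[ℂ] ℂ) := inferInstance
  exact hli.finite

theorem algebraic_reflexivity_of_diamPreserving_bijections
    {X Y : Type*} [TopologicalSpace X] [CompactSpace X] [T2Space X]
    [FirstCountableTopology X]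
    [TopologicalSpace Y] [CompactSpace Y] [T2Space Y]
    [FirstCountableTopology Y]
    (T : C(X, ℂ) →ₗ[ℂ] C(Y, ℂ)) (hT : LocalDiamPreserving T) :
    DiamPreserving ⇑T ∧ Function.Bijective T := by
  have hd : DiamPreserving ⇑T := fun f => by
    obtain ⟨S, -, hS, h⟩ := hT f
    rw [h, hS f]
  have hinj : Function.Injective T := by
    refine (injective_iff_map_eq_zero T).2 fun f hf => ?_
    obtain ⟨S, hb, -, h⟩ := hT f
    exact hb.1 ((h.symm.trans hf).trans (map_zero S).symm)
  refine ⟨hd, hinj, ?_⟩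
  obtain ⟨S, hS, -, -⟩ := hT 0
  let e := LinearEquiv.ofBijective S hS
  by_cases hX : Finite X
  · have : FiniteDimensional ℂ C(X, ℂ) := FiniteDimensional.of_injective
      (coeFnLinearMap ℂ : C(X, ℂ) →ₗ[ℂ] X → ℂ) DFunLike.coe_injective
    have : FiniteDimensional ℂ C(Y, ℂ) := e.finiteDimensional
    exact (LinearMap.injective_iff_surjective_of_finrank_eq_finrank e.finrank_eq).1 hinj
  have : Infinite X := not_finite_iff_infinite.1 hX
  have : Infinite Y := by
    refine not_finite_iff_infinite.1 fun hY => hX ?_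
    have : FiniteDimensional ℂ C(Y, ℂ) := FiniteDimensional.of_injective
      (coeFnLinearMap ℂ : C(Y, ℂ) →ₗ[ℂ] Y → ℂ) DFunLike.coe_injective
    have : FiniteDimensional ℂ C(X, ℂ) := e.symm.finiteDimensional
    exact finite_of_finiteDimensional_continuousMap
  have hloc : LocallyInjectiveComp T := fun f => by
    obtain ⟨S, hb, hS, h⟩ := hT f
    obtain ⟨c, ψ, L, hc, hψ, hform⟩ := hS.exists_injective_eq_comp_add hb
    exact ⟨c, ψ, L f, hc, hψ, fun y => by rw [h, hform]⟩
  exact hloc.surjective hd hinj
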